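/- For every binary path P with P ≠ u^{|P|} and P ≠ u^{|P|−1}d, the height of the lowest valley of the filling of P equals the height of the lowest valley of P plus one: lv(P̃) = lv(P) + 1. -/

import Mathlib

/-- A binary path is a list of steps: `true` = upstep `u`, `false` = downstep `d`. -/
abbrev BinPath := List Bool

/-- `ht P k` is the height of the `k`-th point of the path `P` (the point reached
after the first `k` steps). -/
def ht (P : BinPath) (k : ℕ) : ℤ :=
  ((P.take k).map (fun b => if b then (1 : ℤ) else -1)).sum

/-- The lattice order on binary paths of the same length: `P ≤ Q` iff
`hᵢ(P) ≤ hᵢ(Q)` for all `i`. -/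
def pathLe (P Q : BinPath) : Prop :=
  P.length = Q.length ∧ ∀ k, ht P k ≤ ht Q k

def pathLt (P Q : BinPath) : Prop := pathLe P Q ∧ P ≠ Q

/-- The maximum path `1ₙ = uⁿ`. -/
def maxPath (n : ℕ) : BinPath := List.replicate n true

/-- Step `i` (0-based) of `P` is a downstep whose endpoint is a valley, i.e. it is
followed by an upstep or it is the last step of `P`. -/
def isValley (P : BinPath) (i : ℕ) : Prop :=
  i < P.length ∧ P.getD i true = false ∧ P.getD (i + 1) true = true

/-- The number of valleys of `P`. -/
def numValleys (P : BinPath) : ℕ :=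
  ((Finset.range P.length).filter
    (fun i => P.getD i true = false ∧ P.getD (i + 1) true = true)).card

/-- The filling of `P`: every valley of `P` is turned into a peak
(each occurrence `du` whose middle point is a valley becomes `ud`, and a final
valley-`d` becomes `u`). -/
def fill (P : BinPath) : BinPath :=
  List.ofFn (fun i : Fin P.length =>
    if P.get i then P.getD (i.1 - 1) true else P.getD (i.1 + 1) true)

/-- The degree of `P`: the least `k` such that the `k`-fold iterated filling
of `P` is the maximum path. -/
noncomputable def degree (P : BinPath) : ℕ :=
  sInf {k | fill^[k] P = maxPath P.length}

/-- `fPath P` is the number of chains from `P` to the maximum path `1_{|P|}` of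
length `degree P` having small intervals. -/
noncomputable def fPath (P : BinPath) : ℕ :=
  Set.ncard {c : ℕ → BinPath |
    c 0 = P ∧ (∀ i, degree P ≤ i → c i = maxPath P.length) ∧
    ∀ i < degree P, pathLt (c i) (c (i + 1)) ∧ pathLe (c (i + 1)) (fill (c i))}

/-- Height of the lowest valley of `P`. -/
noncomputable def lv (P : BinPath) : ℤ :=
  sInf {h : ℤ | ∃ i, isValley P i ∧ ht P (i + 1) = h}

/-- Height of the highest valley of `P`. -/
noncomputable def hv (P : BinPath) : ℤ :=
  sSup {h : ℤ | ∃ i, isValley P i ∧ ht P (i + 1) = h}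

noncomputable def hvNat (P : BinPath) : ℕ := (hv P).toNat

/-- `P′`: every low valley of `P` is turned into a peak. -/
noncomputable def lowFill (P : BinPath) : BinPath :=
  List.ofFn (fun i : Fin P.length =>
    if P.get i then
      (if P.getD (i.1 - 1) true = false ∧ ht P i.1 = lv P then false else true)
    else
      (if P.getD (i.1 + 1) true = true ∧ ht P (i.1 + 1) = lv P then true else false))

/-- `P*`: every valley of `P` is turned into a peak, except the last one when `P`
ends with a downstep. -/
def starFill (P : BinPath) : BinPath :=
  List.ofFn (fun i : Fin P.length =>
    if i.1 + 1 = P.length ∧ P.get i = false then false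
    else if P.get i then P.getD (i.1 - 1) true else P.getD (i.1 + 1) true)

/-- A Dyck path: starts and ends at height 0 and lies weakly above height 0. -/
def IsDyck (P : BinPath) : Prop := ht P P.length = 0 ∧ ∀ k, 0 ≤ ht P k

/-- A Dyck prefix: a prefix of a Dyck path. -/
def IsDyckPrefix (P : BinPath) : Prop := ∃ Q : BinPath, IsDyck (P ++ Q)

/-- A Dyck suffix: a suffix of a Dyck path. -/
def IsDyckSuffix (P : BinPath) : Prop := ∃ Q : BinPath, IsDyck (Q ++ P)

/-- The pyramid `u^m d^m`. -/
def pyramid (m : ℕ) : BinPath := List.replicate m true ++ List.replicate m false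

/-- Cardinality of the interval `[P, Q]` in the lattice of binary paths. -/
noncomputable def intervalCard (P Q : BinPath) : ℕ :=
  Set.ncard {R : BinPath | pathLe P R ∧ pathLe R Q}

/-- `I(s) = |[s, u^{|s|/2} d^{|s|/2}]|`. -/
noncomputable def Ifun (s : BinPath) : ℕ := intervalCard s (pyramid (s.length / 2))

/-- `J(P) = |[P, u^{|P|}]|`. -/
noncomputable def Jfun (P : BinPath) : ℕ := intervalCard P (maxPath P.length)

/-- `P` and `Q` have exactly the same valleys at every height at most `m`. -/
def sameValleysUpTo (P Q : BinPath) (m : ℤ) : Prop :=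
  ∀ (i : ℕ) (t : ℤ), t ≤ m →
    ((isValley P i ∧ ht P (i + 1) = t) ↔ (isValley Q i ∧ ht Q (i + 1) = t))

/-- A multichain of Dyck paths of type `V` from `a` to `s`: it has length
`h = hv(a)` and for every `j ∈ [h]` its `(j-1)`-st and `j`-th members have the
same valleys at every height at most `h - j`.  (The function `σ` is frozen from
index `h` on, so that such multichains are counted correctly.) -/
def IsVChain (a s : BinPath) (σ : ℕ → BinPath) : Prop :=
  σ 0 = a ∧ (∀ j, hvNat a ≤ j → σ j = s) ∧ (∀ j, IsDyck (σ j)) ∧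
  (∀ j < hvNat a, pathLe (σ j) (σ (j + 1))) ∧
  (∀ j, 1 ≤ j → j ≤ hvNat a →
    sameValleysUpTo (σ (j - 1)) (σ j) ((hvNat a : ℤ) - (j : ℤ)))

/-- `V(a,s)`: the number of `a`–`s` multichains of type `V`. -/
noncomputable def VPath (a s : BinPath) : ℕ :=
  Set.ncard {σ : ℕ → BinPath | IsVChain a s σ}

/-- `ζ^k(P,Q)`: the number of `P`–`Q` multichains of length `k`. -/
noncomputable def zetaPow (k : ℕ) (P Q : BinPath) : ℕ :=
  Set.ncard {c : ℕ → BinPath |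
    c 0 = P ∧ (∀ i, k ≤ i → c i = Q) ∧ ∀ i < k, pathLe (c i) (c (i + 1))}

/-- The join of two paths of the same length (pointwise max of heights). -/
def pathSup (P Q : BinPath) : BinPath :=
  List.ofFn (fun i : Fin P.length =>
    decide (max (ht P i.1) (ht Q i.1) < max (ht P (i.1 + 1)) (ht Q (i.1 + 1))))

/-- The meet of two paths of the same length (pointwise min of heights). -/
def pathInf (P Q : BinPath) : BinPath :=
  List.ofFn (fun i : Fin P.length =>
    decide (min (ht P i.1) (ht Q i.1) < min (ht P (i.1 + 1)) (ht Q (i.1 + 1))))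

/-- `Q` covers `P` in the lattice of binary paths. -/
def pathCovBy (P Q : BinPath) : Prop :=
  pathLt P Q ∧ ∀ R : BinPath, pathLt P R → pathLt R Q → False

/-- `l(P,Q) = (1/2)·Σᵢ (hᵢ(Q) − hᵢ(P))`. -/
def lpq (P Q : BinPath) : ℕ :=
  ((∑ i ∈ Finset.range P.length, (ht Q (i + 1) - ht P (i + 1))) / 2).toNat

/-- Convolution in the incidence algebra of the lattice of binary paths. -/
noncomputable def conv (F G : BinPath → BinPath → ℤ) : BinPath → BinPath → ℤ :=
  fun P Q => ∑ᶠ (R : BinPath) (_ : pathLe P R ∧ pathLe R Q), F P R * G R Q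

/-- The delta function of the incidence algebra. -/
def deltaFun : BinPath → BinPath → ℤ := fun P Q => if P = Q then 1 else 0

/-- `μ^k`: the `k`-th convolution power of `μ` (`μ^0` is the delta function). -/
noncomputable def muPow (mu : BinPath → BinPath → ℤ) (k : ℕ) : BinPath → BinPath → ℤ :=
  (conv mu)^[k] deltaFun

theorem ht_succ {P : BinPath} {k : ℕ} (hk : k < P.length) :
    ht P (k + 1) = ht P k + if P.getD k true then 1 else -1 := by
  rw [List.getD_eq_getElem _ _ hk, ht, ht, List.take_add_one, List.getElem?_eq_getElem hk,
    List.map_append, List.sum_append]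
  simp

theorem ht_succ_of_true {P : BinPath} {k : ℕ} (hk : k < P.length) (h : P.getD k true = true) :
    ht P (k + 1) = ht P k + 1 := by
  rw [ht_succ hk, if_pos h]

theorem ht_succ_of_false {P : BinPath} {k : ℕ} (hk : k < P.length) (h : P.getD k true = false) :
    ht P (k + 1) = ht P k - 1 := by
  rw [ht_succ hk, h]; rfl

theorem lt_length_of_getD_false {P : BinPath} {i : ℕ} (h : P.getD i true = false) :
    i < P.length := by
  by_contra hi
  rw [List.getD_eq_default _ _ (not_lt.mp hi)] at h
  simp at h

theorem length_fill (P : BinPath) : (fill P).length = P.length := by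
  simp [fill]

theorem getD_fill {P : BinPath} {i : ℕ} (hi : i < P.length) :
    (fill P).getD i true =
      if P.getD i true then P.getD (i - 1) true else P.getD (i + 1) true := by
  rw [List.getD_eq_getElem _ _ ((length_fill P).symm ▸ hi), List.getD_eq_getElem _ _ hi]
  simp [fill]

/-- Filling raises exactly the valleys of a path, each by two units. -/
theorem ht_fill_succ {P : BinPath} {k : ℕ} (hk : k < P.length) :
    ht (fill P) (k + 1) =
      ht P (k + 1) + if P.getD k true = false ∧ P.getD (k + 1) true = true then 2 else 0 := by
  induction k with
  | zero =>
    rw [ht_succ hk, ht_succ ((length_fill P).symm ▸ hk), getD_fill hk]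
    cases h : P.getD 0 true <;> cases h' : P.getD 1 true <;> simp_all [ht]
  | succ k ih =>
    rw [ht_succ hk, ht_succ ((length_fill P).symm ▸ hk), getD_fill hk, ih (by omega)]
    cases h : P.getD (k + 1) true <;> cases h' : P.getD (k + 2) true <;>
      cases h'' : P.getD k true <;> simp_all <;> ring

theorem neg_le_ht {P : BinPath} {k : ℕ} (hk : k ≤ P.length) : -(k : ℤ) ≤ ht P k := by
  induction k with
  | zero => simp [ht]
  | succ k ih =>
    have := ih (by omega)
    rw [ht_succ hk]
    push_cast
    split_ifs <;> linarith

theorem bddBelow_valley_heights (P : BinPath) :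
    BddBelow {h : ℤ | ∃ i, isValley P i ∧ ht P (i + 1) = h} := by
  refine ⟨-(P.length : ℤ), ?_⟩
  rintro _ ⟨i, hi, rfl⟩
  have := neg_le_ht (P := P) (k := i + 1) hi.1
  have := hi.1
  push_cast at *
  linarith

theorem lv_le_of_isValley {P : BinPath} {i : ℕ} (hi : isValley P i) : lv P ≤ ht P (i + 1) :=
  csInf_le (bddBelow_valley_heights P) ⟨i, hi, rfl⟩

/-- After any downstep the path reaches a valley at most as high as its endpoint. -/
theorem exists_isValley_le {P : BinPath} {i : ℕ} (h : P.getD i true = false) :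
    ∃ j, isValley P j ∧ ht P (j + 1) ≤ ht P (i + 1) := by
  have hi := lt_length_of_getD_false h
  induction hm : P.length - i generalizing i with
  | zero => omega
  | succ m ih =>
    cases h' : P.getD (i + 1) true
    · have hi' := lt_length_of_getD_false h'
      obtain ⟨j, hj, hle⟩ := ih h' hi' (by omega)
      rw [ht_succ_of_false hi' h'] at hle
      exact ⟨j, hj, by linarith⟩
    · exact ⟨i, ⟨hi, h, h'⟩, le_rfl⟩

/-- From the first downstep on, the path stays weakly above its lowest valley. -/
theorem lv_le_ht {P : BinPath} {i k : ℕ} (h : P.getD i true = false) (hik : i < k)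
    (hk : k ≤ P.length) : lv P ≤ ht P k := by
  induction k, hik using Nat.le_induction with
  | base =>
    obtain ⟨j, hj, hle⟩ := exists_isValley_le h
    exact (lv_le_of_isValley hj).trans hle
  | succ k hik ih =>
    cases h' : P.getD k true
    · obtain ⟨j, hj, hle⟩ := exists_isValley_le h'
      exact (lv_le_of_isValley hj).trans hle
    · rw [ht_succ_of_true hk h']
      linarith [ih (by omega)]

theorem exists_isValley_eq_lv {P : BinPath} {i : ℕ} (h : P.getD i true = false) :
    ∃ j, isValley P j ∧ ht P (j + 1) = lv P := by
  obtain ⟨j, hj, -⟩ := exists_isValley_le h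
  have hne : {h : ℤ | ∃ i, isValley P i ∧ ht P (i + 1) = h}.Nonempty := ⟨_, j, hj, rfl⟩
  exact Int.csInf_mem hne (bddBelow_valley_heights P)

theorem lv_add_one_le_of_isValley_fill {P : BinPath} {i : ℕ} (hi : isValley (fill P) i) :
    lv P + 1 ≤ ht (fill P) (i + 1) := by
  obtain ⟨hlt, hd, hu⟩ := hi
  rw [length_fill] at hlt
  rw [getD_fill hlt] at hd
  rw [ht_fill_succ hlt]
  cases h : P.getD i true
  · have h' : P.getD (i + 1) true = false := by rwa [h, if_neg (by simp)] at hd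
    have hlt' := lt_length_of_getD_false h'
    have := lv_le_ht h' (Nat.lt_succ_self _) hlt'
    rw [Nat.succ_eq_add_one, ht_succ_of_false hlt' h'] at this
    split_ifs <;> linarith
  · have h' : P.getD (i - 1) true = false := by rwa [h, if_pos rfl] at hd
    obtain _ | i := i
    · simp_all
    · have := lv_le_ht (k := i + 1) h' (by simp) hlt.le
      rw [ht_succ_of_true hlt h]
      split_ifs <;> linarith

theorem exists_false_of_ne_maxPath {P : BinPath} (h : P ≠ maxPath P.length) :
    ∃ i, P.getD i true = false := by
  by_contra! hn
  refine h (List.eq_replicate_iff.mpr ⟨rfl, fun b hb => ?_⟩)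
  obtain ⟨i, hi, rfl⟩ := List.getElem_of_mem hb
  have := hn i
  rw [List.getD_eq_getElem _ _ hi] at this
  simpa using this

/-- A path ending with its only downstep has the form `uⁿ⁻¹d`. -/
theorem eq_replicate_append_of_forall_true {P : BinPath} {n : ℕ} (hn : P.length = n + 1)
    (hlast : P.getD n true = false) (h : ∀ i < n, P.getD i true = true) :
    P = List.replicate (P.length - 1) true ++ [false] := by
  refine List.ext_getElem (by simp [hn]) fun i hi _ => ?_
  rw [← List.getD_eq_getElem P true hi]
  rcases Nat.lt_succ_iff_lt_or_eq.mp (hn ▸ hi : i < n + 1) with hlt | rfl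
  · rw [h i hlt, List.getElem_append_left (by simpa [hn] using hlt)]
    simp
  · rw [hlast, List.getElem_append_right (by simp [hn])]
    simp

theorem exists_isValley_fill_eq {P : BinPath} (h1 : P ≠ maxPath P.length)
    (h2 : P ≠ List.replicate (P.length - 1) true ++ [false]) :
    ∃ i, isValley (fill P) i ∧ ht (fill P) (i + 1) = lv P + 1 := by
  obtain ⟨i₀, hi₀⟩ := exists_false_of_ne_maxPath h1
  obtain ⟨k, ⟨hk, hd, hu⟩, hlv⟩ := exists_isValley_eq_lv hi₀
  by_cases hk' : k + 1 < P.length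
  · -- the upstep following the lowest valley becomes a downstep ending in a valley
    refine ⟨k + 1, ⟨by rwa [length_fill], ?_, ?_⟩, ?_⟩
    · rw [getD_fill hk', hu]
      simpa using hd
    · by_cases hk2 : k + 2 < P.length
      · rw [getD_fill hk2]
        cases h : P.getD (k + 2) true
        · cases h3 : P.getD (k + 3) true
          · have hk3 := lt_length_of_getD_false h3
            have := lv_le_ht h3 (Nat.lt_succ_self _) hk3
            rw [Nat.succ_eq_add_one, ht_succ_of_false hk3 h3, ht_succ_of_false hk2 h,
              ht_succ_of_true hk' hu] at this
            linarith
          · simp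
        · simpa using hu
      · exact List.getD_eq_default _ _ (by rw [length_fill]; omega)
    · rw [ht_fill_succ hk', ht_succ_of_true hk' hu, hu]
      simp [hlv]
  · -- the lowest valley is the endpoint of the path
    have hn : P.length = k + 1 := by omega
    obtain ⟨j, hj, hjd⟩ : ∃ j < k, P.getD j true = false := by
      by_contra! hn'
      exact h2 (eq_replicate_append_of_forall_true hn hd fun i hi => by simpa using hn' i hi)
    obtain ⟨m, rfl⟩ : ∃ m, k = m + 1 := ⟨k - 1, by omega⟩
    have hm : m < P.length := by omega
    have hm1 : ht P (m + 1) = lv P + 1 := by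
      rw [ht_succ_of_false hk hd] at hlv
      linarith
    refine ⟨m, ⟨by rwa [length_fill], ?_, ?_⟩, ?_⟩
    · rw [getD_fill hm, hd]
      cases h : P.getD m true
      · simp
      · cases h' : P.getD (m - 1) true
        · simp
        · have hjm : j ≠ m := by rintro rfl; simp_all
          obtain ⟨l, rfl⟩ : ∃ l, m = l + 1 := ⟨m - 1, by omega⟩
          have hjl : j ≠ l := by rintro rfl; simp_all
          have := lv_le_ht (k := l) hjd (by omega) (by omega)
          rw [Nat.add_sub_cancel] at h'
          rw [ht_succ_of_true hm h, ht_succ_of_true (by omega) h'] at hm1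
          linarith
    · rw [getD_fill hk, hd]
      simpa using hu
    · rw [ht_fill_succ hm, hd, hm1]
      simp

/-- For every binary path `P` with `P ≠ u^{|P|}` and
`P ≠ u^{|P|−1}d`, we have `lv(P̃) = lv(P) + 1`. -/
theorem statement5 (P : BinPath)
    (h1 : P ≠ maxPath P.length)
    (h2 : P ≠ List.replicate (P.length - 1) true ++ [false]) :
    lv (fill P) = lv P + 1 := by
  obtain ⟨i, hi, hlv⟩ := exists_isValley_fill_eq h1 h2
  refine le_antisymm (hlv ▸ lv_le_of_isValley hi) (le_csInf ⟨_, i, hi, rfl⟩ ?_)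
  rintro _ ⟨j, hj, rfl⟩
  exact lv_add_one_le_of_isValley_fill hj
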